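/- Let M = (M,<,…) be an almost o-minimal structure, let D ⊆ M be a definable discrete set, and let a < b in M. Then every definable function F : (a,b) → D has finite range. -/

import Mathlib

open FirstOrder FirstOrder.Language

universe u v w x

/-- A subset of a linear order is an open interval (possibly unbounded). -/
def IsOpenIntervalSet {M : Type w} [LinearOrder M] (s : Set M) : Prop :=
  (∃ a b : M, s = Set.Ioo a b) ∨ (∃ a : M, s = Set.Ioi a) ∨ (∃ b : M, s = Set.Iio b) ∨
    s = Set.univ

/-- `s` is a finite union of points and open intervals. -/
def IsFinUnionPointsIntervals {M : Type w} [LinearOrder M] (s : Set M) : Prop :=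
  ∃ (F : Finset M) (n : ℕ) (J : Fin n → Set M),
    (∀ k, IsOpenIntervalSet (J k)) ∧ s = ↑F ∪ ⋃ k, J k

/-- `M` is o-minimal: every subset of `M` definable with parameters is a finite union of
points and open intervals. -/
def IsOMinimal (L : FirstOrder.Language.{u, v}) (M : Type w) [L.Structure M]
    [LinearOrder M] : Prop :=
  ∀ s : Set M, (Set.univ : Set M).Definable₁ L s → IsFinUnionPointsIntervals s

/-- `M` is almost o-minimal: every bounded definable (with parameters) subset of `M` is a
finite union of points and open intervals. -/
def IsAlmostOMinimal (L : FirstOrder.Language.{u, v}) (M : Type w) [L.Structure M]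
    [LinearOrder M] : Prop :=
  ∀ s : Set M, (Set.univ : Set M).Definable₁ L s → BddAbove s → BddBelow s →
    IsFinUnionPointsIntervals s

/-- `M` is downward o-minimal: every definable (with parameters) subset of `M` that is
bounded above is a finite union of points and open intervals. -/
def IsDownwardOMinimal (L : FirstOrder.Language.{u, v}) (M : Type w) [L.Structure M]
    [LinearOrder M] : Prop :=
  ∀ s : Set M, (Set.univ : Set M).Definable₁ L s → BddAbove s → IsFinUnionPointsIntervals s

/-- `M` is upward o-minimal: every definable (with parameters) subset of `M` that is
bounded below is a finite union of points and open intervals. -/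
def IsUpwardOMinimal (L : FirstOrder.Language.{u, v}) (M : Type w) [L.Structure M]
    [LinearOrder M] : Prop :=
  ∀ s : Set M, (Set.univ : Set M).Definable₁ L s → BddBelow s → IsFinUnionPointsIntervals s

/-- A subset `D` of a linear order is discrete if every point of `D` has an open interval
around it containing no other point of `D`. -/
def IsDiscreteSet {M : Type w} [LinearOrder M] (D : Set M) : Prop :=
  ∀ x ∈ D, ∃ l r : M, l < x ∧ x < r ∧ ∀ z ∈ D, z ∈ Set.Ioo l r → z = x

section Definability

variable {L : FirstOrder.Language.{u, v}} {M : Type w} [L.Structure M] {A : Set M} {α : Type*}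

theorem Set.Definable.ofPred_and {p q : (α → M) → Prop} (hp : A.Definable L {v | p v})
    (hq : A.Definable L {v | q v}) : A.Definable L {v | p v ∧ q v} :=
  hp.inter hq

theorem Set.Definable.ofPred_or {p q : (α → M) → Prop} (hp : A.Definable L {v | p v})
    (hq : A.Definable L {v | q v}) : A.Definable L {v | p v ∨ q v} :=
  hp.union hq

theorem Set.Definable.ofPred_not {p : (α → M) → Prop} (hp : A.Definable L {v | p v}) :
    A.Definable L {v | ¬ p v} :=
  hp.compl

theorem Set.Definable.ofPred_imp {p q : (α → M) → Prop} (hp : A.Definable L {v | p v})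
    (hq : A.Definable L {v | q v}) : A.Definable L {v | p v → q v} := by
  simpa only [imp_iff_not_or] using hp.ofPred_not.ofPred_or hq

theorem Set.Definable.ofPred_exists {p : (α → M) → M → Prop}
    (hp : A.Definable L {w : α ⊕ Unit → M | p (fun i => w (.inl i)) (w (.inr ()))}) :
    A.Definable L {v | ∃ x, p v x} := by
  convert! hp.exists_of_finite using 1
  ext v
  exact ⟨fun ⟨x, hx⟩ => ⟨fun _ => x, hx⟩, fun ⟨u, hu⟩ => ⟨u (), hu⟩⟩

theorem Set.Definable.ofPred_forall {p : (α → M) → M → Prop}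
    (hp : A.Definable L {w : α ⊕ Unit → M | p (fun i => w (.inl i)) (w (.inr ()))}) :
    A.Definable L {v | ∀ x, p v x} := by
  convert! hp.forall_of_finite using 1
  ext v
  exact ⟨fun h u => h (u ()), fun h x => h fun _ => x⟩

theorem Set.Definable.ofPred_rel {r : M → M → Prop}
    (hr : A.Definable L {v : Fin 2 → M | r (v 0) (v 1)}) {f g : (α → M) → M}
    (hf : A.DefinableFun L f) (hg : A.DefinableFun L g) :
    A.Definable L {v | r (f v) (g v)} := by
  refine hr.preimage_map (F := fun v => ![f v, g v]) fun i => ?_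
  fin_cases i
  exacts [hf, hg]

theorem definable_ofPred_le [L.IsOrdered] [LE M] [L.OrderedStructure M] {f g : (α → M) → M}
    (hf : A.DefinableFun L f) (hg : A.DefinableFun L g) :
    A.Definable L {v | f v ≤ g v} := by
  refine Set.Definable.ofPred_rel (r := (· ≤ ·)) ?_ hf hg
  refine (Set.empty_definable_iff.2 ⟨(Term.var (.inl 0)).le (Term.var (.inl 1)), ?_⟩).mono
    (Set.empty_subset A)
  ext v
  simp [Formula.Realize, Term.realize_le]

theorem definable_ofPred_lt [L.IsOrdered] [LinearOrder M] [L.OrderedStructure M]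
    {f g : (α → M) → M} (hf : A.DefinableFun L f) (hg : A.DefinableFun L g) :
    A.Definable L {v | f v < g v} := by
  simpa only [not_le] using (definable_ofPred_le hg hf).ofPred_not

theorem definableFun_const_univ (c : M) :
    (Set.univ : Set M).DefinableFun L (fun _ : α → M => c) :=
  definableFun_const L α (Set.mem_univ c)

end Definability

section Order

variable {M : Type w} [LinearOrder M]

theorem IsOpenIntervalSet.exists_Ioo_subset [NoMinOrder M] [NoMaxOrder M] {s : Set M}
    (hs : IsOpenIntervalSet s) (hne : s.Nonempty) : ∃ p q, p < q ∧ Set.Ioo p q ⊆ s := by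
  obtain ⟨x, hx⟩ := hne
  obtain ⟨l, hl⟩ := exists_lt x
  obtain ⟨r, hr⟩ := exists_gt x
  rcases hs with ⟨a, b, rfl⟩ | ⟨a, rfl⟩ | ⟨b, rfl⟩ | rfl
  · exact ⟨a, b, hx.1.trans hx.2, subset_rfl⟩
  · exact ⟨a, x, hx, fun y hy => hy.1⟩
  · exact ⟨x, b, hx, fun y hy => hy.2⟩
  · exact ⟨l, r, hl.trans hr, Set.subset_univ _⟩

theorem IsOpenIntervalSet.exists_left_endpoint [NoMinOrder M] {s : Set M}
    (hs : IsOpenIntervalSet s) (hne : s.Nonempty) (hb : BddBelow s) :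
    ∃ e x, e < x ∧ Set.Ioo e x ⊆ s ∧ ∀ y ∈ s, e < y := by
  obtain ⟨x, hx⟩ := hne
  obtain ⟨c, hc⟩ := hb
  obtain ⟨c', hc'⟩ := exists_lt c
  have hcx := hc hx
  rcases hs with ⟨a, b, rfl⟩ | ⟨a, rfl⟩ | ⟨b, rfl⟩ | rfl
  · exact ⟨a, b, hx.1.trans hx.2, subset_rfl, fun y hy => hy.1⟩
  · exact ⟨a, x, hx, fun y hy => hy.1, fun y hy => hy⟩
  · exact absurd (hc (show c' ∈ Set.Iio b from (hc'.trans_le hcx).trans hx)) hc'.not_ge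
  · exact absurd (hc (Set.mem_univ c')) hc'.not_ge

theorem IsFinUnionPointsIntervals.exists_Ioo_subset [NoMinOrder M] [NoMaxOrder M] {s : Set M}
    (hs : IsFinUnionPointsIntervals s) (hinf : s.Infinite) :
    ∃ p q, p < q ∧ Set.Ioo p q ⊆ s := by
  obtain ⟨F, n, J, hJ, rfl⟩ := hs
  by_cases h : ∃ k, (J k).Nonempty
  · obtain ⟨k, hk⟩ := h
    obtain ⟨p, q, hpq, hsub⟩ := (hJ k).exists_Ioo_subset hk
    exact ⟨p, q, hpq, fun x hx => Or.inr (Set.mem_iUnion.2 ⟨k, hsub hx⟩)⟩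
  · refine absurd (F.finite_toSet.subset ?_) hinf
    rintro x (hx | hx)
    · exact hx
    · obtain ⟨k, hk⟩ := Set.mem_iUnion.1 hx
      exact absurd ⟨k, x, hk⟩ h

/-- A nonempty finite union of points and intervals that is bounded below either has a least
element or starts with an open interval. -/
theorem IsFinUnionPointsIntervals.isLeast_or_Ioo_subset [NoMinOrder M] {s : Set M}
    (hs : IsFinUnionPointsIntervals s) (hne : s.Nonempty) (hb : BddBelow s) :
    (∃ m, IsLeast s m) ∨ ∃ e x, e < x ∧ Set.Ioo e x ⊆ s ∧ ∀ y ∈ s, e < y := by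
  obtain ⟨F, n, J, hJ, rfl⟩ := hs
  have hJs : ∀ k, J k ⊆ ↑F ∪ ⋃ k, J k := fun k =>
    (Set.subset_iUnion J k).trans Set.subset_union_right
  choose e x hex hsub hlt using fun k : {k // (J k).Nonempty} =>
    (hJ k).exists_left_endpoint k.2 (hb.mono (hJs k))
  have hbelow : ∀ y ∈ (↑F ∪ ⋃ k, J k : Set M), ∃ c ∈ (↑F ∪ Set.range e : Set M), c ≤ y := by
    rintro y (hy | hy)
    · exact ⟨y, Or.inl hy, le_rfl⟩
    · obtain ⟨k, hk⟩ := Set.mem_iUnion.1 hy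
      exact ⟨_, Or.inr ⟨⟨k, y, hk⟩, rfl⟩, (hlt ⟨k, y, hk⟩ y hk).le⟩
  have hfin : (↑F ∪ Set.range e : Set M).Finite := F.finite_toSet.union (Set.finite_range e)
  obtain ⟨y₀, hy₀⟩ := hne
  obtain ⟨c₀, hc₀, -⟩ := hbelow y₀ hy₀
  obtain ⟨m, hm, hmin⟩ := Set.exists_min_image _ id hfin ⟨c₀, hc₀⟩
  have hle : ∀ y ∈ (↑F ∪ ⋃ k, J k : Set M), m ≤ y := fun y hy => by
    obtain ⟨c, hc, hcy⟩ := hbelow y hy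
    exact (hmin c hc).trans hcy
  by_cases hms : m ∈ (↑F ∪ ⋃ k, J k : Set M)
  · exact Or.inl ⟨m, hms, hle⟩
  · obtain hmF | ⟨k, rfl⟩ := hm
    · exact absurd (Or.inl hmF) hms
    · exact Or.inr ⟨e k, x k, hex k, (hsub k).trans (hJs k), fun y hy =>
        (hle y hy).lt_of_ne fun h => hms (h ▸ hy)⟩

theorem IsDiscreteSet.not_Ioo_subset [DenselyOrdered M] {D : Set M} (hD : IsDiscreteSet D)
    {p q : M} (hpq : p < q) : ¬ Set.Ioo p q ⊆ D := by
  intro hsub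
  obtain ⟨x, hpx, hxq⟩ := exists_between hpq
  obtain ⟨l, r, hl, hr, h⟩ := hD x (hsub ⟨hpx, hxq⟩)
  obtain ⟨z, hxz, hz⟩ := exists_between (lt_min hxq hr)
  exact hxz.ne' (h z (hsub ⟨hpx.trans hxz, hz.trans_le (min_le_left _ _)⟩)
    ⟨hl.trans hxz, hz.trans_le (min_le_right _ _)⟩)

/-- Orders `M` by listing `[c, ∞)` upwards, followed by `(-∞, c)` downwards. -/
def FoldLT (c x y : M) : Prop :=
  (c ≤ x ∧ x < y) ∨ (y < c ∧ (c ≤ x ∨ y < x))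

theorem FoldLT.asymm {c x y : M} (h : FoldLT c x y) : ¬ FoldLT c y x := by
  unfold FoldLT at *
  grind

/-- A nonempty set with finite bounded parts has a minimum for `FoldLT c`. -/
theorem exists_foldLT_min (c : M) {S : Set M} (hS : S.Nonempty)
    (hfin : ∀ p q, (S ∩ Set.Icc p q).Finite) : ∃ m ∈ S, ∀ y ∈ S, y ≠ m → FoldLT c m y := by
  by_cases h : ∃ x ∈ S, c ≤ x
  · obtain ⟨x, hx, hcx⟩ := h
    obtain ⟨m, hm, hmin⟩ := Set.exists_min_image _ id (hfin c x) ⟨x, hx, hcx, le_rfl⟩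
    refine ⟨m, hm.1, fun y hy hne => ?_⟩
    have := hmin y
    simp only [Set.mem_inter_iff, Set.mem_Icc, id] at this hm
    unfold FoldLT
    grind
  · obtain ⟨x, hx⟩ := hS
    push Not at h
    obtain ⟨m, hm, hmax⟩ := Set.exists_max_image _ id (hfin x c) ⟨x, hx, le_rfl, (h x hx).le⟩
    refine ⟨m, hm.1, fun y hy hne => ?_⟩
    have := hmax y
    have := h y hy
    simp only [Set.mem_inter_iff, Set.mem_Icc, id] at *
    unfold FoldLT
    grind

end Order

section AlmostOMinimal

variable {L : FirstOrder.Language.{u, v}} [L.IsOrdered] {M : Type w}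
  [LinearOrder M] [L.Structure M] [L.OrderedStructure M]
  [DenselyOrdered M] [NoMinOrder M] [NoMaxOrder M]

/-- The bounded parts of a definable discrete set are finite. -/
theorem IsAlmostOMinimal.finite_inter_Icc (hM : IsAlmostOMinimal L M) {D : Set M}
    (hDdef : (Set.univ : Set M).Definable₁ L D) (hD : IsDiscreteSet D) (p q : M) :
    (D ∩ Set.Icc p q).Finite := by
  by_contra hinf
  have hdef : (Set.univ : Set M).Definable₁ L (D ∩ Set.Icc p q) :=
    hDdef.inter ((definable_ofPred_le (definableFun_const_univ p) (.proj L)).ofPred_and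
      (definable_ofPred_le (.proj L) (definableFun_const_univ q)))
  obtain ⟨p', q', hpq, hsub⟩ := (hM _ hdef ⟨q, fun x hx => hx.2.2⟩
    ⟨p, fun x hx => hx.2.1⟩).exists_Ioo_subset hinf
  exact hD.not_Ioo_subset hpq fun x hx => (hsub hx).1

/-- An almost o-minimal structure has no definable asymmetric relation for which every
subinterval of an interval has a minimum: such a relation makes the set of those `x` whose nearest
smaller elements `l < x < r` satisfy `ρ l r` dense and codense. -/
theorem IsAlmostOMinimal.not_forall_Ioo_exists_min (hM : IsAlmostOMinimal L M)
    {ρ : M → M → Prop} (hρ : (Set.univ : Set M).Definable L {v : Fin 2 → M | ρ (v 0) (v 1)})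
    (hasymm : ∀ x y, ρ x y → ¬ ρ y x) {p q : M} (hpq : p < q) :
    ¬ ∀ p' q', p ≤ p' → p' < q' → q' ≤ q →
      ∃ m ∈ Set.Ioo p' q', ∀ z ∈ Set.Ioo p' q', z ≠ m → ρ m z := by
  intro hmin
  let P : Set M := {x | ∃ l r, l < x ∧ x < r ∧ ρ l x ∧ ρ r x ∧ ρ l r ∧
    ∀ z, l < z → z < r → z = x ∨ ρ x z}
  have hP : (Set.univ : Set M).Definable₁ L P := by
    refine .ofPred_exists (.ofPred_exists ?_)
    refine (definable_ofPred_lt (.proj L) (.proj L)).ofPred_and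
      ((definable_ofPred_lt (.proj L) (.proj L)).ofPred_and
      ((hρ.ofPred_rel (.proj L) (.proj L)).ofPred_and
      ((hρ.ofPred_rel (.proj L) (.proj L)).ofPred_and
      ((hρ.ofPred_rel (.proj L) (.proj L)).ofPred_and
      (.ofPred_forall ((definable_ofPred_lt (.proj L) (.proj L)).ofPred_imp
      ((definable_ofPred_lt (.proj L) (.proj L)).ofPred_imp
      (.ofPred_or (Set.DefinableFun.ofPred_eq (.proj L) (.proj L))
      (hρ.ofPred_rel (.proj L) (.proj L))))))))))
  have hI : (Set.univ : Set M).Definable₁ L (Set.Ioo p q) :=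
    (definable_ofPred_lt (definableFun_const_univ p) (.proj L)).ofPred_and
      (definable_ofPred_lt (.proj L) (definableFun_const_univ q))
  have key : ∀ p' q', p ≤ p' → p' < q' → q' ≤ q →
      (∃ x ∈ Set.Ioo p' q', x ∈ P) ∧ ∃ x ∈ Set.Ioo p' q', x ∉ P := by
    intro p' q' hp hlt hq
    obtain ⟨x₀, ⟨hx₀l, hx₀r⟩, h₀⟩ := hmin p' q' hp hlt hq
    obtain ⟨x₁, ⟨hx₁l, hx₁r⟩, h₁⟩ := hmin x₀ q' (hp.trans hx₀l.le) hx₀r hq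
    obtain ⟨x₂, ⟨hx₂l, hx₂r⟩, h₂⟩ := hmin x₀ x₁ (hp.trans hx₀l.le) hx₁l (hx₁r.le.trans hq)
    obtain ⟨x₃, ⟨hx₃l, hx₃r⟩, h₃⟩ := hmin x₂ x₁ (hp.trans (hx₀l.trans hx₂l).le) hx₂r
      (hx₁r.le.trans hq)
    have h02 : ρ x₀ x₂ := h₀ _ ⟨hx₀l.trans hx₂l, hx₂r.trans hx₁r⟩ hx₂l.ne'
    have h01 : ρ x₀ x₁ := h₀ _ ⟨hx₀l.trans hx₁l, hx₁r⟩ hx₁l.ne'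
    have h12 : ρ x₁ x₂ := h₁ _ ⟨hx₂l, hx₂r.trans hx₁r⟩ hx₂r.ne
    have h13 : ρ x₁ x₃ := h₁ _ ⟨hx₂l.trans hx₃l, hx₃r.trans hx₁r⟩ hx₃r.ne
    have h23 : ρ x₂ x₃ := h₂ _ ⟨hx₂l.trans hx₃l, hx₃r⟩ hx₃l.ne'
    refine ⟨⟨x₂, ⟨hx₀l.trans hx₂l, hx₂r.trans hx₁r⟩, x₀, x₁, hx₂l, hx₂r, h02, h12, h01,
      fun z hz hz' => or_iff_not_imp_left.2 (h₂ z ⟨hz, hz'⟩)⟩,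
      x₃, ⟨(hx₀l.trans hx₂l).trans hx₃l, hx₃r.trans hx₁r⟩, ?_⟩
    rintro ⟨l, r, hl, hr, hρl, hρr, hlr, hz⟩
    have hl2 : l = x₂ := by
      rcases lt_trichotomy l x₂ with h | h | h
      · rcases hz x₂ h (hx₃l.trans hr) with h' | h'
        · exact absurd h' hx₃l.ne
        · exact absurd h' (hasymm _ _ h23)
      · exact h
      · exact absurd hρl (hasymm _ _ (h₃ l ⟨h, hl.trans hx₃r⟩ hl.ne))
    have hr1 : r = x₁ := by
      rcases lt_trichotomy r x₁ with h | h | h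
      · exact absurd hρr (hasymm _ _ (h₃ r ⟨hx₃l.trans hr, h⟩ hr.ne'))
      · exact h
      · rcases hz x₁ (hl.trans hx₃r) h with h' | h'
        · exact absurd h' hx₃r.ne'
        · exact absurd h' (hasymm _ _ h13)
    subst hl2 hr1
    exact hasymm _ _ h12 hlr
  have hsubI : ∀ {p' q'}, p' < q' → Set.Ioo p' q' ⊆ Set.Ioo p q → p ≤ p' ∧ q' ≤ q :=
    fun h hsub => (Set.Ioo_subset_Ioo_iff h).1 hsub
  have hinf : (Set.Ioo p q ∩ P ∪ Set.Ioo p q \ P).Infinite := by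
    rw [Set.inter_union_sdiff]
    exact Set.Ioo_infinite hpq
  rcases Set.infinite_union.1 hinf with h | h
  · obtain ⟨p', q', hlt, hsub⟩ := (hM (Set.Ioo p q ∩ P) (hI.inter hP) ⟨q, fun x hx => hx.1.2.le⟩
      ⟨p, fun x hx => hx.1.1.le⟩).exists_Ioo_subset h
    obtain ⟨hp, hq⟩ := hsubI hlt fun x hx => (hsub hx).1
    obtain ⟨x, hx, hxP⟩ := (key p' q' hp hlt hq).2
    exact hxP (hsub hx).2
  · obtain ⟨p', q', hlt, hsub⟩ := (hM (Set.Ioo p q \ P) (hI.sdiff hP) ⟨q, fun x hx => hx.1.2.le⟩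
      ⟨p, fun x hx => hx.1.1.le⟩).exists_Ioo_subset h
    obtain ⟨hp, hq⟩ := hsubI hlt fun x hx => (hsub hx).1
    obtain ⟨x, hx, hxP⟩ := (key p' q' hp hlt hq).1
    exact (hsub hx).2 hxP

/-- A definable function with infinite range on a bounded interval is injective on a
subinterval. -/
theorem IsAlmostOMinimal.exists_injOn_Ioo (hM : IsAlmostOMinimal L M) {a b : M} {F : M → M}
    (hF : (Set.univ : Set M).Definable L
      {v : Fin 2 → M | v 0 ∈ Set.Ioo a b ∧ v 1 = F (v 0)})
    (hinf : (F '' Set.Ioo a b).Infinite) :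
    ∃ p q, p < q ∧ Set.Ioo p q ⊆ Set.Ioo a b ∧ Set.InjOn F (Set.Ioo p q) := by
  let G : M → M → Prop := fun x u => x ∈ Set.Ioo a b ∧ u = F x
  have hG : (Set.univ : Set M).Definable L {v : Fin 2 → M | G (v 0) (v 1)} := hF
  let S : Set M := {x | ∃ u, G x u ∧ ∀ y, y < x → ¬ G y u}
  have hS : (Set.univ : Set M).Definable₁ L S :=
    .ofPred_exists ((hG.ofPred_rel (.proj L) (.proj L)).ofPred_and
      (.ofPred_forall ((definable_ofPred_lt (.proj L) (.proj L)).ofPred_imp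
        (hG.ofPred_rel (.proj L) (.proj L)).ofPred_not)))
  let E : Set M := {e | ∃ d x, e < x ∧ (∀ z, e < z → z < x → G z d) ∧ ∀ y, y ≤ e → ¬ G y d}
  have hE : (Set.univ : Set M).Definable₁ L E := by
    refine .ofPred_exists (.ofPred_exists ?_)
    refine (definable_ofPred_lt (.proj L) (.proj L)).ofPred_and (.ofPred_and ?_ ?_)
    · exact .ofPred_forall ((definable_ofPred_lt (.proj L) (.proj L)).ofPred_imp
        ((definable_ofPred_lt (.proj L) (.proj L)).ofPred_imp
        (hG.ofPred_rel (.proj L) (.proj L))))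
    · exact .ofPred_forall ((definable_ofPred_le (.proj L) (.proj L)).ofPred_imp
        (hG.ofPred_rel (.proj L) (.proj L)).ofPred_not)
  have hSinj : Set.InjOn F S := by
    rintro x ⟨_, ⟨hx, rfl⟩, hx'⟩ y ⟨_, ⟨hy, rfl⟩, hy'⟩ hxy
    rcases lt_trichotomy x y with h | h | h
    · exact absurd ⟨hx, hxy.symm⟩ (hy' x h)
    · exact h
    · exact absurd ⟨hy, hxy⟩ (hx' y h)
  have hSsub : S ⊆ Set.Ioo a b := fun x ⟨_, hx, _⟩ => hx.1
  have hSinf : S.Infinite := by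
    intro hSfin
    have hEfin : E.Finite := by
      by_contra hEinf
      have hEI : E ⊆ Set.Icc a b := by
        rintro e ⟨d, x, hex, hG', -⟩
        obtain ⟨z, hez, hzx⟩ := exists_between hex
        refine ⟨le_of_not_gt fun h => ?_, (hez.trans (hG' z hez hzx).1.2).le⟩
        obtain ⟨y, hey, hy⟩ := exists_between (lt_min h hex)
        exact (hG' y hey (hy.trans_le (min_le_right _ _))).1.1.not_gt
          (hy.trans_le (min_le_left _ _))
      obtain ⟨p, q, hpq, hsub⟩ := (hM _ hE ⟨b, fun x hx => (hEI hx).2⟩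
        ⟨a, fun x hx => (hEI hx).1⟩).exists_Ioo_subset hEinf
      obtain ⟨e, hpe, heq⟩ := exists_between hpq
      obtain ⟨d, x, hex, hd, -⟩ := hsub ⟨hpe, heq⟩
      obtain ⟨e', hee', he'⟩ := exists_between (lt_min heq hex)
      have he'x := he'.trans_le (min_le_right _ _)
      obtain ⟨d', x', hex', hd', hnot⟩ := hsub ⟨hpe.trans hee', he'.trans_le (min_le_left _ _)⟩
      obtain ⟨z, hz, hz'⟩ := exists_between (lt_min he'x hex')
      have hdd : d = d' := (hd z (hee'.trans hz) (hz'.trans_le (min_le_left _ _))).2.trans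
        (hd' z hz (hz'.trans_le (min_le_right _ _))).2.symm
      exact hnot e' le_rfl (hdd ▸ hd e' hee' he'x)
    choose! g hg using fun e (he : e ∈ E) => he
    refine hinf (((hSfin.image F).union (hEfin.image g)).subset ?_)
    rintro _ ⟨x₀, hx₀, rfl⟩
    have hfib : (Set.univ : Set M).Definable₁ L {x | G x (F x₀)} :=
      hG.ofPred_rel (.proj L) (definableFun_const_univ (F x₀))
    have hbdd : BddBelow {x | G x (F x₀)} := ⟨a, fun x hx => hx.1.1.le⟩
    rcases (hM _ hfib ⟨b, fun x hx => hx.1.2.le⟩ hbdd).isLeast_or_Ioo_subset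
      ⟨x₀, hx₀, rfl⟩ hbdd with ⟨m, hm, hmin⟩ | ⟨e, x, hex, hsub, hlt⟩
    · exact Or.inl ⟨m, ⟨F x₀, hm, fun y hy hGy => (hmin hGy).not_gt hy⟩, hm.2.symm⟩
    · have he : e ∈ E := ⟨F x₀, x, hex, fun z hz hz' => hsub ⟨hz, hz'⟩,
        fun y hy hGy => (hlt y hGy).not_ge hy⟩
      obtain ⟨x', hex', hG', -⟩ := hg e he
      obtain ⟨z, hz, hz'⟩ := exists_between (lt_min hex hex')
      refine Or.inr ⟨e, he, ?_⟩
      exact (hG' z hz (hz'.trans_le (min_le_right _ _))).2.trans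
        (hsub ⟨hz, hz'.trans_le (min_le_left _ _)⟩).2.symm
  obtain ⟨p, q, hpq, hsub⟩ := (hM _ hS ⟨b, fun x hx => (hSsub hx).2.le⟩
    ⟨a, fun x hx => (hSsub hx).1.le⟩).exists_Ioo_subset hSinf
  exact ⟨p, q, hpq, hsub.trans hSsub, hSinj.mono hsub⟩

end AlmostOMinimal

/-- Let `M` be an almost o-minimal structure expanding a dense linear
order without endpoints, `D ⊆ M` a definable discrete set and `a < b` in `M`.  Then every
definable function `F : (a,b) → D` (a function whose values on `(a,b)` lie in `D` and
whose graph is a definable subset of `M²`) has finite range on `(a,b)`. -/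
theorem finite_range_of_definable_function_into_discrete
    {L : FirstOrder.Language.{u, v}} [L.IsOrdered] {M : Type w}
    [LinearOrder M] [L.Structure M] [L.OrderedStructure M]
    [DenselyOrdered M] [NoMinOrder M] [NoMaxOrder M]
    (halmost : IsAlmostOMinimal L M)
    (D : Set M) (hDdef : (Set.univ : Set M).Definable₁ L D) (hDdisc : IsDiscreteSet D)
    (a b : M) (hab : a < b)
    (F : M → M)
    (hFD : ∀ x ∈ Set.Ioo a b, F x ∈ D)
    (hFdef : (Set.univ : Set M).Definable L
      {v : Fin 2 → M | v 0 ∈ Set.Ioo a b ∧ v 1 = F (v 0)}) :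
    (F '' Set.Ioo a b).Finite := by
  by_contra hinf
  obtain ⟨p, q, hpq, hsub, hinj⟩ := halmost.exists_injOn_Ioo hFdef hinf
  let G : M → M → Prop := fun x u => x ∈ Set.Ioo a b ∧ u = F x
  have hG : (Set.univ : Set M).Definable L {v : Fin 2 → M | G (v 0) (v 1)} := hFdef
  have hfold : (Set.univ : Set M).Definable L {v : Fin 2 → M | FoldLT a (v 0) (v 1)} :=
    ((definable_ofPred_le (definableFun_const_univ a) (.proj L)).ofPred_and
      (definable_ofPred_lt (.proj L) (.proj L))).ofPred_or
      ((definable_ofPred_lt (.proj L) (definableFun_const_univ a)).ofPred_and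
      ((definable_ofPred_le (definableFun_const_univ a) (.proj L)).ofPred_or
      (definable_ofPred_lt (.proj L) (.proj L))))
  refine halmost.not_forall_Ioo_exists_min
    (ρ := fun x y => ∃ s t, G x s ∧ G y t ∧ FoldLT a s t) ?_ ?_ hpq ?_
  · exact .ofPred_exists (.ofPred_exists ((hG.ofPred_rel (.proj L) (.proj L)).ofPred_and
      ((hG.ofPred_rel (.proj L) (.proj L)).ofPred_and (hfold.ofPred_rel (.proj L) (.proj L)))))
  · rintro x y ⟨_, _, ⟨-, rfl⟩, ⟨-, rfl⟩, h⟩ ⟨_, _, ⟨-, rfl⟩, ⟨-, rfl⟩, h'⟩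
    exact h.asymm h'
  · intro p' q' hp hlt hq
    have hsub' := Set.Ioo_subset_Ioo hp hq
    obtain ⟨_, ⟨m, hm, rfl⟩, hmin⟩ := exists_foldLT_min a ((Set.nonempty_Ioo.2 hlt).image F)
      fun c d => (halmost.finite_inter_Icc hDdef hDdisc c d).subset
        (Set.inter_subset_inter_left _
          (Set.image_subset_iff.2 fun x hx => hFD x (hsub (hsub' hx))))
    exact ⟨m, hm, fun z hz hne => ⟨F m, F z, ⟨hsub (hsub' hm), rfl⟩, ⟨hsub (hsub' hz), rfl⟩,
      hmin _ ⟨z, hz, rfl⟩ fun h => hne (hinj (hsub' hz) (hsub' hm) h)⟩⟩
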